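/- arXiv:1501.00602 — 2 statements merged into one kernel-verified Lean document; each statement's English description precedes it below -/
import Mathlib

section
/- Let q be a prime power, n ≥ 3, and let 𝒞 be a subset of the space 𝒬_n of quadratic forms in n variables over F_q such that the difference of any two distinct elements of 𝒞 has weight at least 3. Then |𝒞| < q^{(n−1)(n−2)/2}. -/
open Module Submodule

/-- The weight of a quadratic form (homogeneous degree-2 polynomial): the least `k`
such that it is a sum of `k` products of two linear forms. -/
noncomputable def wt {F : Type*} [Field F] {n : ℕ} (Q : MvPolynomial (Fin n) F) : ℕ :=
  sInf {k | ∃ l l' : Fin k → MvPolynomial (Fin n) F,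
    (∀ i, (l i).IsHomogeneous 1 ∧ (l' i).IsHomogeneous 1) ∧ Q = ∑ i, l i * l' i}

section CharacterSums

variable {F : Type*} [Field F]

/-- A finite field admits `x ↦ x ^ 2 - x` missing some value. -/
theorem exists_sq_ne_add_self [Finite F] : ∃ a : F, ∀ r : F, r ^ 2 ≠ a + 1 * r := by
  have hni : ¬ Function.Injective (fun r : F => r ^ 2 - r) := fun h =>
    zero_ne_one (h (by simp : (0 : F) ^ 2 - 0 = 1 ^ 2 - 1))
  have hns : ¬ Function.Surjective (fun r : F => r ^ 2 - r) := fun h =>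
    hni (Finite.injective_iff_surjective.2 h)
  simp only [Function.Surjective, not_forall, not_exists] at hns
  obtain ⟨a, ha⟩ := hns
  exact ⟨a, fun r hr => ha r (by rw [hr]; ring)⟩

theorem sum_addChar_linearMap [Fintype F] {ψ : AddChar F ℂ} (hψ : ψ.IsPrimitive) {M : Type*}
    [AddCommGroup M] [Module F M] [Fintype M] (f : M →ₗ[F] F) [Decidable (f = 0)] :
    ∑ m, ψ (f m) = if f = 0 then (Fintype.card M : ℂ) else 0 := by
  split_ifs with hf
  · simp [hf]
  · have hne : ψ.compAddMonoidHom f.toAddMonoidHom ≠ 1 := by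
      intro h1
      obtain ⟨m, hm⟩ : ∃ m, f m ≠ 0 := by
        by_contra! hc
        exact hf (LinearMap.ext hc)
      apply hψ hm
      ext y
      have := DFunLike.congr_fun h1 (y • m)
      simpa [AddChar.mulShift_apply, mul_comm] using this
    simpa using AddChar.sum_eq_zero_of_ne_one hne

/-- The character sum of a bilinear form only depends on the size of its kernel. -/
theorem sum_sum_addChar_bilin [Fintype F] {ψ : AddChar F ℂ} (hψ : ψ.IsPrimitive) {V : Type*}
    [AddCommGroup V] [Module F V] [Fintype V] (B : V →ₗ[F] V →ₗ[F] F) :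
    ∑ u, ∑ v, ψ (B u v) = Fintype.card V * (Nat.card (LinearMap.ker B) : ℂ) := by
  classical
  simp_rw [sum_addChar_linearMap hψ]
  rw [← Finset.sum_filter, Finset.sum_const, nsmul_eq_mul, mul_comm, Nat.card_eq_fintype_card,
    Fintype.card_subtype]
  simp [LinearMap.mem_ker]

/-- The coordinatewise real part with respect to a quadratic algebra. -/
def reVec (a : F) (n : ℕ) : (Fin n → QuadraticAlgebra F a 1) →ₗ[F] (Fin n → F) where
  toFun w i := (w i).re
  map_add' _ _ := rfl
  map_smul' _ _ := rfl

/-- The coordinatewise imaginary part with respect to a quadratic algebra. -/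
def imVec (a : F) (n : ℕ) : (Fin n → QuadraticAlgebra F a 1) →ₗ[F] (Fin n → F) where
  toFun w i := (w i).im
  map_add' _ _ := rfl
  map_smul' _ _ := rfl

variable {a : F} {n : ℕ} {M : Type*} [AddCommGroup M] [Module F M]

/-- The Hermitian norm attached to a symmetric bilinear map by a quadratic algebra. -/
def normForm (P : (Fin n → F) →ₗ[F] (Fin n → F) →ₗ[F] M)
    (w : Fin n → QuadraticAlgebra F a 1) : M :=
  P (reVec a n w) (reVec a n w) + P (reVec a n w) (imVec a n w)
    - a • P (imVec a n w) (imVec a n w)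

theorem reVec_smul (z : QuadraticAlgebra F a 1) (w : Fin n → QuadraticAlgebra F a 1) :
    reVec a n (z • w) = z.re • reVec a n w + (a * z.im) • imVec a n w := by
  ext i
  simp [reVec, imVec]

theorem imVec_smul (z : QuadraticAlgebra F a 1) (w : Fin n → QuadraticAlgebra F a 1) :
    imVec a n (z • w) = z.im • reVec a n w + (z.re + z.im) • imVec a n w := by
  ext i
  simp [reVec, imVec]
  ring

theorem normForm_smul {P : (Fin n → F) →ₗ[F] (Fin n → F) →ₗ[F] M} (hP : ∀ u v, P u v = P v u)
    (z : QuadraticAlgebra F a 1) (w : Fin n → QuadraticAlgebra F a 1) :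
    normForm P (z • w) = z.norm • normForm P w := by
  simp only [normForm, reVec_smul, imVec_smul, map_add, map_smul, LinearMap.add_apply,
    LinearMap.smul_apply, QuadraticAlgebra.norm_def, hP (imVec a n w) (reVec a n w)]
  module

/-- The polarization of `normForm`. -/
def normPolar (B : (Fin n → F) →ₗ[F] (Fin n → F) →ₗ[F] F) (d : Fin n → QuadraticAlgebra F a 1) :
    (Fin n → QuadraticAlgebra F a 1) →ₗ[F] F :=
  B ((2 : F) • reVec a n d + imVec a n d) ∘ₗ reVec a n
    + B (reVec a n d - (2 * a) • imVec a n d) ∘ₗ imVec a n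

theorem normForm_add {B : (Fin n → F) →ₗ[F] (Fin n → F) →ₗ[F] F} (hB : ∀ u v, B u v = B v u)
    (w d : Fin n → QuadraticAlgebra F a 1) :
    normForm B (w + d) = normForm B w + (normForm B d + normPolar B d w) := by
  simp only [normForm, normPolar, map_add, map_sub, map_smul, LinearMap.add_apply,
    LinearMap.sub_apply, LinearMap.smul_apply, LinearMap.comp_apply, smul_eq_mul,
    hB (reVec a n w) (reVec a n d), hB (reVec a n w) (imVec a n d),
    hB (imVec a n w) (imVec a n d)]
  ring

/-- The equivalence between coordinate vectors over a quadratic algebra and pairs of vectors. -/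
def vecEquivProd (a : F) (n : ℕ) :
    (Fin n → QuadraticAlgebra F a 1) ≃ (Fin n → F) × (Fin n → F) where
  toFun w := (reVec a n w, imVec a n w)
  invFun p i := ⟨p.1 i, p.2 i⟩
  left_inv _ := rfl
  right_inv _ := rfl

theorem four_mul_add_one_ne_zero (ha : ∀ r : F, r ^ 2 ≠ a + 1 * r) : 4 * a + 1 ≠ 0 := by
  intro h
  by_cases h2 : (2 : F) = 0
  · apply one_ne_zero (α := F)
    linear_combination h - 2 * a * h2
  · apply ha (1 / 2)
    field_simp
    linear_combination -h

theorem normPolar_eq_zero_iff (ha : ∀ r : F, r ^ 2 ≠ a + 1 * r)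
    (B : (Fin n → F) →ₗ[F] (Fin n → F) →ₗ[F] F) (d : Fin n → QuadraticAlgebra F a 1) :
    normPolar B d = 0 ↔ reVec a n d ∈ LinearMap.ker B ∧ imVec a n d ∈ LinearMap.ker B := by
  have h4 := four_mul_add_one_ne_zero ha
  constructor
  · intro h
    have h1 : (2 : F) • B (reVec a n d) + B (imVec a n d) = 0 := by
      refine LinearMap.ext fun u => ?_
      have hu : reVec a n ((vecEquivProd a n).symm (u, 0)) = u := rfl
      have hu' : imVec a n ((vecEquivProd a n).symm (u, 0)) = 0 := rfl
      have := LinearMap.congr_fun h ((vecEquivProd a n).symm (u, 0))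
      simpa only [normPolar, LinearMap.zero_apply, LinearMap.add_apply, LinearMap.comp_apply,
        hu, hu', map_zero,
        add_zero, map_add, map_smul] using this
    have h2 : B (reVec a n d) - (2 * a) • B (imVec a n d) = 0 := by
      refine LinearMap.ext fun u => ?_
      have hu : reVec a n ((vecEquivProd a n).symm (0, u)) = 0 := rfl
      have hu' : imVec a n ((vecEquivProd a n).symm (0, u)) = u := rfl
      have := LinearMap.congr_fun h ((vecEquivProd a n).symm (0, u))
      simpa only [normPolar, LinearMap.zero_apply, LinearMap.add_apply, LinearMap.comp_apply,
        hu, hu', map_zero,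
        zero_add, map_sub, map_smul] using this
    have h3 : (4 * a + 1) • B (reVec a n d) = 0 := by
      rw [eq_neg_of_add_eq_zero_right h1] at h2
      rw [← h2]
      module
    have h5 : B (reVec a n d) = 0 := (smul_eq_zero.1 h3).resolve_left h4
    rw [h5] at h1
    exact ⟨h5, by simpa using h1⟩
  · rintro ⟨h1, h2⟩
    rw [LinearMap.mem_ker] at h1 h2
    simp [normPolar, h1, h2]

theorem norm_surjective_quadraticAlgebra [Finite F] (ha : ∀ r : F, r ^ 2 ≠ a + 1 * r) (x : F) :
    ∃ z : QuadraticAlgebra F a 1, z.norm = x := by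
  have : Fact (∀ r : F, r ^ 2 ≠ a + 1 * r) := ⟨ha⟩
  have : Finite (QuadraticAlgebra F a 1) := Finite.of_equiv _ (QuadraticAlgebra.equivProd a 1).symm
  obtain ⟨z, hz⟩ := FiniteField.norm_surjective F (QuadraticAlgebra F a 1) x
  exact ⟨z, by rw [← hz, ← QuadraticAlgebra.det_toLinearMap_eq_norm]; rfl⟩

instance [Fintype F] : Fintype (QuadraticAlgebra F a 1) :=
  Fintype.ofEquiv _ (QuadraticAlgebra.equivProd a 1).symm

theorem card_quadraticAlgebra [Fintype F] :
    Fintype.card (QuadraticAlgebra F a 1) = Fintype.card F ^ 2 := by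
  rw [Fintype.card_congr (QuadraticAlgebra.equivProd a 1), Fintype.card_prod, sq]

/-- The isotropic vectors of a Hermitian form come in orbits of size `q ^ 2 - 1`. -/
theorem card_normForm_eq_zero [Fintype F] [DecidableEq F] (ha : ∀ r : F, r ^ 2 ≠ a + 1 * r)
    {B : (Fin n → F) →ₗ[F] (Fin n → F) →ₗ[F] F} (hB : ∀ u v, B u v = B v u) :
    ∃ k : ℕ, Fintype.card {w : Fin n → QuadraticAlgebra F a 1 // normForm B w = 0}
      = 1 + k * (Fintype.card F ^ 2 - 1) := by
  classical
  have : Fact (∀ r : F, r ^ 2 ≠ a + 1 * r) := ⟨ha⟩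
  let X : SubMulAction (QuadraticAlgebra F a 1)ˣ (Fin n → QuadraticAlgebra F a 1) :=
    { carrier := {w | normForm B w = 0 ∧ w ≠ 0}
      smul_mem' := by
        rintro z w ⟨hw, hw0⟩
        refine ⟨?_, by simpa only [ne_eq, smul_eq_zero_iff_eq] using hw0⟩
        rw [Units.smul_def, normForm_smul hB, hw, smul_zero] }
  have hstab : ∀ b : X, MulAction.stabilizer (QuadraticAlgebra F a 1)ˣ b = ⊥ := fun b => by
    rw [X.stabilizer_of_subMul, Module.stabilizer_units_eq_bot_of_ne_zero _ b.property.2]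
  have hX : Nat.card X = Nat.card (Quotient (MulAction.orbitRel (QuadraticAlgebra F a 1)ˣ X))
      * (Fintype.card F ^ 2 - 1) := by
    rw [Nat.card_congr (MulAction.selfEquivOrbitsQuotientProd hstab), Nat.card_prod,
      Nat.card_eq_fintype_card (α := (QuadraticAlgebra F a 1)ˣ), Fintype.card_units,
      card_quadraticAlgebra]
  refine ⟨Nat.card (Quotient (MulAction.orbitRel (QuadraticAlgebra F a 1)ˣ X)), ?_⟩
  rw [← hX, Fintype.card_subtype]
  have h0 : (0 : Fin n → QuadraticAlgebra F a 1) ∈ Finset.univ.filter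
      (fun w : Fin n → QuadraticAlgebra F a 1 => normForm B w = 0) := by
    rw [Finset.mem_filter]
    simp [normForm]
  rw [← Finset.card_erase_add_one h0, add_comm]
  congr 1
  rw [← Nat.card_eq_finsetCard]
  refine Nat.card_congr (Equiv.subtypeEquivRight fun w => ?_)
  simp only [Finset.mem_erase, Finset.mem_filter, Finset.mem_univ, true_and]
  exact and_comm

variable [Fintype F] {ψ : AddChar F ℂ}

theorem sum_addChar_mul_normForm (ha : ∀ r : F, r ^ 2 ≠ a + 1 * r)
    {B : (Fin n → F) →ₗ[F] (Fin n → F) →ₗ[F] F} (hB : ∀ u v, B u v = B v u) {c : F} (hc : c ≠ 0) :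
    ∑ w : Fin n → QuadraticAlgebra F a 1, ψ (c * normForm B w) =
      ∑ w : Fin n → QuadraticAlgebra F a 1, ψ (normForm B w) := by
  have : Fact (∀ r : F, r ^ 2 ≠ a + 1 * r) := ⟨ha⟩
  obtain ⟨z, rfl⟩ := norm_surjective_quadraticAlgebra ha c
  have hz : z ≠ 0 := by
    rintro rfl
    simp at hc
  refine Fintype.sum_equiv (MulAction.toPerm (Units.mk0 z hz)) _ _ fun w => ?_
  rw [MulAction.toPerm_apply, Units.smul_mk0, normForm_smul hB, smul_eq_mul]

theorem card_mul_card_normForm_eq_zero [DecidableEq F] (hψ : ψ.IsPrimitive)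
    (ha : ∀ r : F, r ^ 2 ≠ a + 1 * r)
    {B : (Fin n → F) →ₗ[F] (Fin n → F) →ₗ[F] F} (hB : ∀ u v, B u v = B v u) :
    (Fintype.card F : ℂ) * Fintype.card {w : Fin n → QuadraticAlgebra F a 1 // normForm B w = 0}
      = (Fintype.card F : ℂ) ^ (2 * n)
        + (Fintype.card F - 1) * ∑ w : Fin n → QuadraticAlgebra F a 1, ψ (normForm B w) := by
  have h1 : ∑ w : Fin n → QuadraticAlgebra F a 1, ∑ c : F, ψ (c * normForm B w)
      = (Fintype.card F : ℂ)
        * Fintype.card {w : Fin n → QuadraticAlgebra F a 1 // normForm B w = 0} := by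
    simp_rw [AddChar.sum_mulShift _ hψ]
    rw [Fintype.card_subtype, ← Nat.cast_mul, mul_comm, ← smul_eq_mul, ← Finset.sum_const,
      Finset.sum_filter]
    push_cast
    rfl
  rw [← h1, Finset.sum_comm, ← Finset.add_sum_erase _ _ (Finset.mem_univ (0 : F))]
  congr 1
  · simp [card_quadraticAlgebra, pow_mul]
  · rw [Finset.sum_congr rfl fun c hc => sum_addChar_mul_normForm ha hB (Finset.ne_of_mem_erase hc)]
    simp [Finset.card_erase_of_mem, Nat.cast_sub Fintype.card_pos]

theorem sum_addChar_normForm_sq (hψ : ψ.IsPrimitive) (ha : ∀ r : F, r ^ 2 ≠ a + 1 * r)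
    {B : (Fin n → F) →ₗ[F] (Fin n → F) →ₗ[F] F} (hB : ∀ u v, B u v = B v u) :
    (∑ w : Fin n → QuadraticAlgebra F a 1, ψ (normForm B w)) ^ 2
      = ((Fintype.card F : ℂ) ^ n * Nat.card (LinearMap.ker B)) ^ 2 := by
  classical
  rw [sq]
  nth_rewrite 2 [← sum_addChar_mul_normForm ha hB (neg_ne_zero.2 one_ne_zero)]
  rw [Finset.sum_mul_sum, Finset.sum_comm]
  have h1 : ∀ w : Fin n → QuadraticAlgebra F a 1,
      ∑ w' : Fin n → QuadraticAlgebra F a 1, ψ (normForm B w') * ψ (-1 * normForm B w)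
      = ∑ d : Fin n → QuadraticAlgebra F a 1, ψ (normForm B d) * ψ (normPolar B d w) := by
    intro w
    rw [← Equiv.sum_comp (Equiv.addLeft w)]
    refine Finset.sum_congr rfl fun d _ => ?_
    rw [Equiv.coe_addLeft, normForm_add hB, ← AddChar.map_add_eq_mul, ← AddChar.map_add_eq_mul]
    congr 1
    ring
  simp_rw [h1]
  rw [Finset.sum_comm]
  simp_rw [← Finset.mul_sum, sum_addChar_linearMap hψ]
  have h2 : ∀ d : Fin n → QuadraticAlgebra F a 1,
      ψ (normForm B d) * (if normPolar B d = 0 then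
        (Fintype.card (Fin n → QuadraticAlgebra F a 1) : ℂ) else 0)
      = if reVec a n d ∈ LinearMap.ker B ∧ imVec a n d ∈ LinearMap.ker B then
        (Fintype.card (Fin n → QuadraticAlgebra F a 1) : ℂ) else 0 := by
    intro d
    simp_rw [← normPolar_eq_zero_iff ha]
    split_ifs with h
    · obtain ⟨h1, h2⟩ := (normPolar_eq_zero_iff ha B d).1 h
      rw [LinearMap.mem_ker] at h1 h2
      simp [normForm, h1, h2]
    · simp
  simp_rw [h2]
  rw [← Equiv.sum_comp (vecEquivProd a n).symm, Fintype.sum_prod_type]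
  have h3 : ∀ u v, (reVec a n ((vecEquivProd a n).symm (u, v)) ∈ LinearMap.ker B ∧
      imVec a n ((vecEquivProd a n).symm (u, v)) ∈ LinearMap.ker B) ↔
      (u ∈ LinearMap.ker B ∧ v ∈ LinearMap.ker B) :=
    fun u v => Iff.rfl
  have h4 : Nat.card (LinearMap.ker B) = (Finset.univ.filter (· ∈ LinearMap.ker B)).card := by
    rw [Nat.card_eq_fintype_card, Fintype.card_subtype]
  simp_rw [h3]
  rw [← Fintype.sum_prod_type', ← Finset.sum_filter, Finset.sum_const, ← Finset.univ_product_univ,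
    Finset.filter_product, Finset.card_product, ← h4]
  simp [card_quadraticAlgebra]
  ring

/-- A Hermitian form of rank `r` has character sum `(-1) ^ r * q ^ (2 * n - r)`. -/
theorem sum_addChar_normForm (hψ : ψ.IsPrimitive) (ha : ∀ r : F, r ^ 2 ≠ a + 1 * r)
    {B : (Fin n → F) →ₗ[F] (Fin n → F) →ₗ[F] F} (hB : ∀ u v, B u v = B v u) {d : ℕ}
    (hd : Nat.card (LinearMap.ker B) = Fintype.card F ^ d) :
    ∑ w : Fin n → QuadraticAlgebra F a 1, ψ (normForm B w)
      = (-1) ^ (n + d) * (Fintype.card F : ℂ) ^ (n + d) := by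
  classical
  have hsq := sum_addChar_normForm_sq hψ ha hB
  obtain ⟨k, hk⟩ := card_normForm_eq_zero ha hB
  have hq := card_mul_card_normForm_eq_zero hψ ha hB
  have hq1 : 1 < Fintype.card F := Fintype.one_lt_card
  rw [hd] at hsq
  rw [hk] at hq
  generalize (∑ w : Fin n → QuadraticAlgebra F a 1, ψ (normForm B w)) = E at *
  generalize Fintype.card F = q at *
  push_cast [Nat.one_le_pow, Nat.cast_sub (Nat.one_le_pow 2 q hq1.le)] at hq hsq
  rw [← pow_add, sq_eq_sq_iff_eq_or_eq_neg] at hsq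
  have hY : ((q : ℤ) + 1) ∣ (q : ℤ) ^ (n + d) - (-1) ^ (n + d) := by
    simpa using sub_dvd_pow_sub_pow (q : ℤ) (-1) (n + d)
  have hm : ((q : ℤ) ^ 2 - 1) ∣ (q : ℤ) ^ (2 * n) - 1 := by
    simpa [pow_mul] using sub_dvd_pow_sub_pow ((q : ℤ) ^ 2) 1 n
  obtain ⟨l, hl⟩ := hY
  obtain ⟨m, hm⟩ := hm
  have hq0 : (q : ℤ) - 1 ≠ 0 := by
    have : (1 : ℤ) < q := by exact_mod_cast hq1
    omega
  have key : ∀ s : ℤ, E = s * (q : ℂ) ^ (n + d) → ((q : ℤ) + 1) ∣ s * (-1) ^ (n + d) - 1 := by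
    rintro s rfl
    have hz : (q : ℤ) * (1 + k * (q ^ 2 - 1)) = q ^ (2 * n) + (q - 1) * (s * q ^ (n + d)) := by
      exact_mod_cast hq
    have h1 : s * (q : ℤ) ^ (n + d) = 1 + (q + 1) * (q * k - m) := by
      apply mul_left_cancel₀ hq0
      linear_combination -hz - hm
    exact ⟨q * k - m - s * l, by linear_combination h1 - s * hl⟩
  have hlt : ¬ ((q : ℤ) + 1) ∣ -2 := by
    rw [dvd_neg]
    intro h
    have := Int.le_of_dvd two_pos h
    omega
  rcases neg_one_pow_eq_or ℤ (n + d) with h | h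
  · have h' : (-1 : ℂ) ^ (n + d) = 1 := by exact_mod_cast congrArg (Int.cast : ℤ → ℂ) h
    rcases hsq with hE | hE
    · rw [hE, h', one_mul]
    · exact absurd (by simpa [h] using key (-1) (by simp [hE])) hlt
  · have h' : (-1 : ℂ) ^ (n + d) = -1 := by exact_mod_cast congrArg (Int.cast : ℤ → ℂ) h
    rcases hsq with hE | hE
    · exact absurd (by simpa [h] using key 1 (by simp [hE])) hlt
    · rw [hE, h', neg_one_mul]

end CharacterSums

section Core

variable {F : Type*} [Field F] {V Q : Type*} [AddCommGroup V] [Module F V] [AddCommGroup Q]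
  [Module F Q]

/-- The quotient of the space of quadratic forms by the ideal of two independent linear forms. -/
theorem finrank_quotient_range_coprod_le [FiniteDimensional F V] [FiniteDimensional F Q]
    {P : V →ₗ[F] V →ₗ[F] Q} (hP : ∀ u v, P u v = P v u)
    (hspan : span F (Set.range fun p : V × V => P p.1 p.2) = ⊤) {x y : V}
    (hxy : LinearIndependent F ![x, y]) :
    finrank F (Q ⧸ LinearMap.range ((P x).coprod (P y))) ≤ (finrank F V - 1).choose 2 := by
  set W := LinearMap.range ((P x).coprod (P y)) with hW
  obtain ⟨S, hS⟩ := Submodule.exists_isCompl (span F (Set.range ![x, y]))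
  have hdim : finrank F S + 2 = finrank F V := by
    have := Submodule.finrank_add_eq_of_isCompl hS
    rw [finrank_span_eq_card hxy, Fintype.card_fin] at this
    omega
  let b := finBasis F S
  let f : Sym2 (Fin (finrank F S)) → Q ⧸ W :=
    Sym2.lift ⟨fun i j => W.mkQ (P (b i) (b j)), fun i j => congrArg W.mkQ (hP _ _)⟩
  have hker : ∀ r ∈ span F (Set.range ![x, y]), ∀ v, W.mkQ (P r v) = 0 := by
    intro r hr v
    rw [Matrix.range_cons, Matrix.range_cons, Matrix.range_empty, Set.union_empty,
      Set.singleton_union, Submodule.mem_span_pair] at hr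
    obtain ⟨α, β, rfl⟩ := hr
    rw [Submodule.mkQ_apply, Submodule.Quotient.mk_eq_zero, hW]
    exact ⟨(α • v, β • v), by simp⟩
  have hS' : ∀ s s' : S, W.mkQ (P s s') ∈ span F (Set.range f) := by
    intro s s'
    rw [← b.sum_repr s, ← b.sum_repr s']
    simp only [Submodule.coe_sum, Submodule.coe_smul, map_sum, map_smul, LinearMap.sum_apply,
      LinearMap.smul_apply]
    refine Submodule.sum_mem _ fun i _ => Submodule.smul_mem _ _ <|
      Submodule.sum_mem _ fun j _ => Submodule.smul_mem _ _ (Submodule.subset_span ?_)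
    exact ⟨s(_, _), rfl⟩
  have htop : span F (Set.range f) = ⊤ := by
    rw [eq_top_iff, ← W.range_mkQ, LinearMap.range_eq_map, ← hspan, Submodule.map_span,
      Submodule.span_le]
    rintro _ ⟨_, ⟨⟨u, v⟩, rfl⟩, rfl⟩
    obtain ⟨r, hr, s, hs, rfl⟩ := Submodule.mem_sup.1
      (hS.sup_eq_top.symm ▸ Submodule.mem_top : u ∈ span F (Set.range ![x, y]) ⊔ S)
    obtain ⟨r', hr', s', hs', rfl⟩ := Submodule.mem_sup.1
      (hS.sup_eq_top.symm ▸ Submodule.mem_top : v ∈ span F (Set.range ![x, y]) ⊔ S)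
    have : W.mkQ (P (r + s) (r' + s')) = W.mkQ (P s s') := by
      rw [map_add P, LinearMap.add_apply, map_add W.mkQ, hker r hr, zero_add, map_add (P s),
        map_add W.mkQ, hP s r', hker r' hr', zero_add]
    simp only [SetLike.mem_coe, this]
    exact hS' ⟨s, hs⟩ ⟨s', hs'⟩
  have h1 := finrank_range_le_card (R := F) f
  rw [Set.finrank, htop, finrank_top, Sym2.card, Fintype.card_fin] at h1
  rwa [show finrank F V - 1 = finrank F S + 1 by omega]

theorem map_normForm {a : F} {n : ℕ} (P : (Fin n → F) →ₗ[F] (Fin n → F) →ₗ[F] Q) (t : Q →ₗ[F] F)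
    (w : Fin n → QuadraticAlgebra F a 1) : t (normForm P w) = normForm (P.compr₂ t) w := by
  simp [normForm]

theorem injOn_mkQ_range_coprod {P : V →ₗ[F] V →ₗ[F] Q} {C : Finset Q}
    (hC : ∀ c ∈ C, ∀ c' ∈ C, c ≠ c' → ∀ u v u' v', c - c' ≠ P u v + P u' v') (x y : V) :
    Set.InjOn (LinearMap.range ((P x).coprod (P y))).mkQ C := by
  intro c hc c' hc' h
  by_contra hne
  rw [Submodule.mkQ_apply, Submodule.mkQ_apply, Submodule.Quotient.eq] at h
  obtain ⟨⟨u, v⟩, h⟩ := h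
  exact hC c hc c' hc' hne x u y v (by simpa using h.symm)

variable [Fintype F] {ψ : AddChar F ℂ}

theorem card_le_of_forall_sub_ne [FiniteDimensional F V] [FiniteDimensional F Q]
    {P : V →ₗ[F] V →ₗ[F] Q} (hP : ∀ u v, P u v = P v u)
    (hspan : span F (Set.range fun p : V × V => P p.1 p.2) = ⊤) {C : Finset Q}
    (hC : ∀ c ∈ C, ∀ c' ∈ C, c ≠ c' → ∀ u v u' v', c - c' ≠ P u v + P u' v')
    (hV : 2 ≤ finrank F V) : C.card ≤ Fintype.card F ^ (finrank F V - 1).choose 2 := by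
  classical
  obtain ⟨g, hg⟩ : ∃ g : Fin 2 → V, LinearIndependent F g :=
    exists_linearIndependent_of_le_finrank hV
  have hxy : LinearIndependent F ![g 0, g 1] := by
    rwa [show ![g 0, g 1] = g from funext fun i => by fin_cases i <;> rfl]
  have hle := finrank_quotient_range_coprod_le hP hspan hxy
  have := Module.finite_of_finite F (M := Q ⧸ LinearMap.range ((P (g 0)).coprod (P (g 1))))
  have := Fintype.ofFinite (Q ⧸ LinearMap.range ((P (g 0)).coprod (P (g 1))))
  rw [← Finset.card_image_of_injOn (injOn_mkQ_range_coprod hC (g 0) (g 1))]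
  refine (Finset.card_le_univ _).trans ?_
  rw [← Nat.card_eq_fintype_card, Module.natCard_eq_pow_finrank (K := F),
    Nat.card_eq_fintype_card]
  exact Nat.pow_le_pow_right Fintype.card_pos hle

theorem sum_addChar_eq_zero_of_two_le_finrank_ker (hψ : ψ.IsPrimitive) [FiniteDimensional F V]
    [FiniteDimensional F Q] {P : V →ₗ[F] V →ₗ[F] Q} (hP : ∀ u v, P u v = P v u)
    (hspan : span F (Set.range fun p : V × V => P p.1 p.2) = ⊤) {C : Finset Q}
    (hC : ∀ c ∈ C, ∀ c' ∈ C, c ≠ c' → ∀ u v u' v', c - c' ≠ P u v + P u' v')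
    (hcard : Fintype.card F ^ (finrank F V - 1).choose 2 ≤ C.card) {t : Q →ₗ[F] F} (ht : t ≠ 0)
    (hker : 2 ≤ finrank F (LinearMap.ker (P.compr₂ t))) :
    ∑ c ∈ C, ψ (t c) = 0 := by
  classical
  obtain ⟨g, hg⟩ : ∃ g : Fin 2 → LinearMap.ker (P.compr₂ t), LinearIndependent F g :=
    exists_linearIndependent_of_le_finrank hker
  have hxy : LinearIndependent F ![(g 0 : V), (g 1 : V)] := by
    have h := hg.map' (Submodule.subtype _) (Submodule.ker_subtype _)
    rwa [show ![(g 0 : V), (g 1 : V)] = Submodule.subtype _ ∘ g from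
      funext fun i => by fin_cases i <;> rfl]
  set W := LinearMap.range ((P (g 0)).coprod (P (g 1))) with hW
  have hle := finrank_quotient_range_coprod_le hP hspan hxy
  rw [← hW] at hle
  have : Finite (Q ⧸ W) := Module.finite_of_finite F
  have : Fintype (Q ⧸ W) := Fintype.ofFinite _
  have hWt : W ≤ LinearMap.ker t := by
    rintro _ ⟨⟨u, v⟩, rfl⟩
    have h0 := LinearMap.congr_fun (LinearMap.mem_ker.1 (g 0).2) u
    have h1 := LinearMap.congr_fun (LinearMap.mem_ker.1 (g 1).2) v
    simp only [LinearMap.compr₂_apply, LinearMap.zero_apply] at h0 h1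
    simp [h0, h1]
  have hinj : Set.InjOn W.mkQ C := injOn_mkQ_range_coprod hC _ _
  have himg : C.image W.mkQ = Finset.univ := by
    apply Finset.eq_univ_of_card
    apply le_antisymm (Finset.card_le_univ _)
    rw [Finset.card_image_of_injOn hinj, ← Nat.card_eq_fintype_card,
      Module.natCard_eq_pow_finrank (K := F), Nat.card_eq_fintype_card]
    exact (Nat.pow_le_pow_right Fintype.card_pos hle).trans hcard
  have hsum : ∑ c ∈ C, ψ (t c) = ∑ y : Q ⧸ W, ψ (W.liftQ t hWt y) := by
    rw [← himg, Finset.sum_image hinj]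
    rfl
  rw [hsum, sum_addChar_linearMap hψ, if_neg]
  intro h
  apply ht
  rw [← W.liftQ_mkQ t hWt, h, LinearMap.zero_comp]

theorem sum_dual_addChar [Finite Q] (hψ : ψ.IsPrimitive) [Fintype (Q →ₗ[F] F)] [DecidableEq Q]
    (x : Q) :
    ∑ t : Q →ₗ[F] F, ψ (t x) = if x = 0 then (Nat.card Q : ℂ) else 0 := by
  classical
  have h := sum_addChar_linearMap hψ (Dual.eval F Q x)
  have hx : Dual.eval F Q x = 0 ↔ x = 0 := by
    rw [LinearMap.ext_iff]
    exact Module.forall_dual_apply_eq_zero_iff F x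
  have hc : Nat.card (Q →ₗ[F] F) = Nat.card Q := by
    rw [Module.natCard_eq_pow_finrank (K := F), Module.natCard_eq_pow_finrank (K := F) (V := Q)]
    exact congrArg _ Subspace.dual_finrank_eq
  rw [← hc, Nat.card_eq_fintype_card]
  simp only [hx] at h
  exact h

/-- Fourier expansion of the number of coincidences between a family of vectors and a
translated code. -/
theorem sum_sum_addChar_mul_sum [Finite Q] (hψ : ψ.IsPrimitive) [Fintype (Q →ₗ[F] F)]
    {C : Finset Q} {c₀ : Q} (hc₀ : c₀ ∈ C) {ι : Type*} [Fintype ι] {g : ι → Q}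
    (hg : ∀ i, ∀ c ∈ C, g i + (c - c₀) = 0 → c = c₀) :
    ∑ t : Q →ₗ[F] F, (∑ i, ψ (t (g i))) * ∑ c ∈ C, ψ (t (c - c₀)) =
      Nat.card Q * (Nat.card {i // g i = 0} : ℂ) := by
  classical
  have h1 : ∀ t : Q →ₗ[F] F, (∑ i, ψ (t (g i))) * ∑ c ∈ C, ψ (t (c - c₀)) =
      ∑ i, ∑ c ∈ C, ψ (t (g i + (c - c₀))) := fun t => by
    simp_rw [Finset.sum_mul_sum, map_add t, AddChar.map_add_eq_mul]
  simp_rw [h1]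
  rw [Finset.sum_comm]
  have h2 : ∀ i, ∑ t : Q →ₗ[F] F, ∑ c ∈ C, ψ (t (g i + (c - c₀))) =
      if g i = 0 then (Nat.card Q : ℂ) else 0 := fun i => by
    rw [Finset.sum_comm, Finset.sum_eq_single_of_mem c₀ hc₀, sum_dual_addChar hψ, sub_self,
      add_zero]
    intro c hc hne
    rw [sum_dual_addChar hψ, if_neg fun h => hne (hg i c hc h)]
  simp_rw [h2]
  rw [← Finset.sum_filter, Finset.sum_const, nsmul_eq_mul, mul_comm,
    Nat.card_eq_fintype_card (α := {i // g i = 0}), Fintype.card_subtype]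

theorem natCard_left_eq_zero_or_right_eq_zero (V : Type*) [Zero V] [Fintype V] :
    Nat.card {p : V × V // p.1 = 0 ∨ p.2 = 0} + 1 = 2 * Fintype.card V := by
  classical
  have h1 : (Finset.univ.filter fun p : V × V => p.1 = 0) = {0} ×ˢ Finset.univ := by
    ext
    rw [Finset.mem_product]
    simp
  have h2 : (Finset.univ.filter fun p : V × V => p.2 = 0) = Finset.univ ×ˢ {0} := by
    ext
    rw [Finset.mem_product]
    simp
  have h3 : ({0} ×ˢ Finset.univ ∩ Finset.univ ×ˢ {0} : Finset (V × V)) = {(0, 0)} := by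
    ext
    rw [Finset.mem_inter, Finset.mem_product, Finset.mem_product]
    simp [Prod.ext_iff]
  have h := Finset.card_union_add_card_inter ({0} ×ˢ Finset.univ : Finset (V × V))
    (Finset.univ ×ˢ {0})
  rw [h3, ← h1, ← h2, ← Finset.filter_or, Finset.card_singleton, h1, h2, Finset.card_product,
    Finset.card_product, Finset.card_singleton, Finset.card_univ] at h
  rw [Nat.card_eq_fintype_card, Fintype.card_subtype, h]
  ring

/-- A combination of the two character sums which annihilates the bilinear forms of corank at
most one. -/
theorem addChar_combination_eq_zero (hψ : ψ.IsPrimitive) {a : F} (ha : ∀ r : F, r ^ 2 ≠ a + 1 * r)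
    {n : ℕ} {B : (Fin n → F) →ₗ[F] (Fin n → F) →ₗ[F] F} (hB : ∀ u v, B u v = B v u)
    (hd : finrank F (LinearMap.ker B) < 2) :
    ((Fintype.card F : ℂ) + 1) * ∑ p : (Fin n → F) × (Fin n → F), ψ (B p.1 p.2)
      + (-1) ^ n * ((Fintype.card F : ℂ) - 1)
        * ∑ w : Fin n → QuadraticAlgebra F a 1, ψ (normForm B w)
      - 2 * (Fintype.card F : ℂ) ^ (n + 1) = 0 := by
  have hcard : Nat.card (LinearMap.ker B) = Fintype.card F ^ finrank F (LinearMap.ker B) := by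
    rw [Module.natCard_eq_pow_finrank (K := F), Nat.card_eq_fintype_card]
  have hs : ((-1 : ℂ) ^ n) ^ 2 = 1 := by rw [← pow_mul, mul_comm, pow_mul]; simp
  rw [Fintype.sum_prod_type, sum_sum_addChar_bilin hψ, sum_addChar_normForm hψ ha hB hcard, hcard,
    Fintype.card_fun, Fintype.card_fin]
  generalize finrank F (LinearMap.ker B) = d at hd
  push_cast
  interval_cases d
  · linear_combination ((Fintype.card F : ℂ) - 1) * (Fintype.card F : ℂ) ^ n * hs
  · linear_combination -((Fintype.card F : ℂ) - 1) * (Fintype.card F : ℂ) ^ (n + 1) * hs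

/-- The identity between the sizes of the ambient space and of an optimal code. -/
theorem natCard_mul_eq_card_mul [FiniteDimensional F Q] {n : ℕ} {a : F}
    (ha : ∀ r : F, r ^ 2 ≠ a + 1 * r) {P : (Fin n → F) →ₗ[F] (Fin n → F) →ₗ[F] Q}
    (hP : ∀ u v, P u v = P v u)
    (hspan : span F (Set.range fun p : (Fin n → F) × (Fin n → F) => P p.1 p.2) = ⊤)
    (hzero : ∀ u v, P u v = 0 → u = 0 ∨ v = 0)
    (haniso : ∀ w : Fin n → QuadraticAlgebra F a 1, normForm P w = 0 → w = 0) {C : Finset Q}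
    (hC : ∀ c ∈ C, ∀ c' ∈ C, c ≠ c' → ∀ u v u' v', c - c' ≠ P u v + P u' v')
    (hcard : Fintype.card F ^ (n - 1).choose 2 ≤ C.card) :
    (Nat.card Q : ℂ) * (((Fintype.card F : ℂ) + 1) * (2 * (Fintype.card F : ℂ) ^ n - 1)
      + (-1) ^ n * ((Fintype.card F : ℂ) - 1) - 2 * (Fintype.card F : ℂ) ^ (n + 1)) =
    C.card * (((Fintype.card F : ℂ) + 1) * (Fintype.card F : ℂ) ^ (2 * n)
      + (-1) ^ n * ((Fintype.card F : ℂ) - 1) * (Fintype.card F : ℂ) ^ (2 * n)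
      - 2 * (Fintype.card F : ℂ) ^ (n + 1)) := by
  classical
  obtain ⟨ψ, hψ⟩ : ∃ ψ : AddChar F ℂ, ψ.IsPrimitive :=
    ⟨_, AddChar.FiniteField.primitiveChar_to_Complex_isPrimitive F⟩
  have : Finite Q := Module.finite_of_finite F
  have : Finite (Q →ₗ[F] F) := Module.finite_of_finite F
  have := Fintype.ofFinite (Q →ₗ[F] F)
  obtain ⟨c₀, hc₀⟩ : C.Nonempty :=
    Finset.card_pos.1 ((Nat.pow_pos Fintype.card_pos).trans_le hcard)
  have hprod := sum_sum_addChar_mul_sum hψ hc₀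
    (g := fun p : (Fin n → F) × (Fin n → F) => P p.1 p.2) fun p c hc h => by
      by_contra hne
      refine hC c hc c₀ hc₀ hne (-p.1) p.2 0 0 ?_
      rw [eq_neg_of_add_eq_zero_right h]
      simp
  have hnorm := sum_sum_addChar_mul_sum hψ hc₀
    (g := fun w : Fin n → QuadraticAlgebra F a 1 => normForm P w) fun w c hc h => by
      by_contra hne
      refine hC c hc c₀ hc₀ hne (-reVec a n w) (reVec a n w + imVec a n w)
        (a • imVec a n w) (imVec a n w) ?_
      rw [eq_neg_of_add_eq_zero_right h, normForm]
      simp only [map_add, map_neg, map_smul, LinearMap.neg_apply, LinearMap.smul_apply]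
      module
  have hone := sum_sum_addChar_mul_sum hψ hc₀ (g := fun _ : Unit => (0 : Q)) fun _ c _ h => by
    rwa [zero_add, sub_eq_zero] at h
  have hcprod : (Nat.card {p : (Fin n → F) × (Fin n → F) // P p.1 p.2 = 0} : ℂ) =
      2 * (Fintype.card F : ℂ) ^ n - 1 := by
    have h := natCard_left_eq_zero_or_right_eq_zero (Fin n → F)
    rw [Fintype.card_fun, Fintype.card_fin] at h
    rw [eq_sub_iff_add_eq]
    rw [Nat.card_congr (Equiv.subtypeEquivRight fun p : (Fin n → F) × (Fin n → F) =>
      (⟨hzero p.1 p.2, by rintro (h | h) <;> simp [h]⟩ : P p.1 p.2 = 0 ↔ p.1 = 0 ∨ p.2 = 0))]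
    exact_mod_cast h
  have hcnorm : Nat.card {w : Fin n → QuadraticAlgebra F a 1 // normForm P w = 0} = 1 := by
    rw [Nat.card_congr (Equiv.subtypeEquivRight fun w : Fin n → QuadraticAlgebra F a 1 =>
      (⟨haniso w, by rintro rfl; simp [normForm]⟩ : normForm P w = 0 ↔ w = 0))]
    simp
  have hcone : Nat.card {_i : Unit // (0 : Q) = 0} = 1 := by simp
  rw [hcprod] at hprod
  rw [hcnorm, Nat.cast_one, mul_one] at hnorm
  rw [hcone, Nat.cast_one, mul_one] at hone
  have key : ∑ t : Q →ₗ[F] F,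
      (((Fintype.card F : ℂ) + 1) * ∑ p : (Fin n → F) × (Fin n → F), ψ (t (P p.1 p.2))
        + (-1) ^ n * ((Fintype.card F : ℂ) - 1)
          * ∑ w : Fin n → QuadraticAlgebra F a 1, ψ (t (normForm P w))
        - 2 * (Fintype.card F : ℂ) ^ (n + 1) * ∑ _i : Unit, ψ (t 0))
        * ∑ c ∈ C, ψ (t (c - c₀)) =
      C.card * (((Fintype.card F : ℂ) + 1) * (Fintype.card F : ℂ) ^ (2 * n)
        + (-1) ^ n * ((Fintype.card F : ℂ) - 1) * (Fintype.card F : ℂ) ^ (2 * n)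
        - 2 * (Fintype.card F : ℂ) ^ (n + 1)) := by
    rw [Finset.sum_eq_single_of_mem 0 (Finset.mem_univ _)]
    · simp only [LinearMap.zero_apply, AddChar.map_zero_eq_one, Finset.sum_const, nsmul_eq_mul,
        mul_one, Finset.card_univ, Fintype.card_prod, Fintype.card_fun, Fintype.card_fin,
        card_quadraticAlgebra, Fintype.card_unit]
      push_cast
      ring
    · intro t _ ht
      by_cases hd : finrank F (LinearMap.ker (P.compr₂ t)) < 2
      · have h := addChar_combination_eq_zero hψ ha (B := P.compr₂ t)
          (fun u v => by simp [hP u v]) hd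
        simp only [map_normForm, map_zero, AddChar.map_zero_eq_one, Finset.sum_const,
          Finset.card_univ, Fintype.card_unit, one_smul, mul_one]
        simp only [LinearMap.compr₂_apply] at h
        rw [h, zero_mul]
      · have h := sum_addChar_eq_zero_of_two_le_finrank_ker hψ hP hspan hC
          (by simpa using hcard) ht (not_lt.1 hd)
        simp_rw [map_sub t, sub_eq_add_neg, AddChar.map_add_eq_mul]
        rw [← Finset.sum_mul, h, zero_mul, mul_zero]
  rw [← key]
  simp only [sub_mul, add_mul, mul_assoc, Finset.sum_sub_distrib, Finset.sum_add_distrib,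
    ← Finset.mul_sum, hprod, hnorm, hone]
  ring

/-- A code of minimum weight three is smaller than the Singleton-type bound. -/
theorem card_lt_of_forall_sub_ne [FiniteDimensional F Q] {n : ℕ} (hn : 3 ≤ n) {a : F}
    (ha : ∀ r : F, r ^ 2 ≠ a + 1 * r) {P : (Fin n → F) →ₗ[F] (Fin n → F) →ₗ[F] Q}
    (hP : ∀ u v, P u v = P v u)
    (hspan : span F (Set.range fun p : (Fin n → F) × (Fin n → F) => P p.1 p.2) = ⊤)
    (hzero : ∀ u v, P u v = 0 → u = 0 ∨ v = 0)
    (haniso : ∀ w : Fin n → QuadraticAlgebra F a 1, normForm P w = 0 → w = 0)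
    (hQ : (n + 1).choose 2 ≤ finrank F Q) {C : Finset Q}
    (hC : ∀ c ∈ C, ∀ c' ∈ C, c ≠ c' → ∀ u v u' v', c - c' ≠ P u v + P u' v') :
    C.card < Fintype.card F ^ (n - 1).choose 2 := by
  by_contra! hcard
  have hid := natCard_mul_eq_card_mul ha hP hspan hzero haniso hC hcard
  have hle := card_le_of_forall_sub_ne hP hspan hC (by simp; omega)
  rw [finrank_fin_fun] at hle
  have hq : 1 < Fintype.card F := Fintype.one_lt_card
  have hbound : Nat.card Q ≤ C.card * Fintype.card F ^ (n + 1) := by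
    have hlt : Fintype.card F < Fintype.card F ^ n := lt_self_pow₀ hq (by omega)
    rcases Nat.even_or_odd n with he | ho
    · have hx : (Fintype.card F : ℂ) ^ n - 1 ≠ 0 := by
        rw [sub_ne_zero]
        exact_mod_cast (hq.trans hlt).ne'
      rw [he.neg_one_pow] at hid
      have h : (Nat.card Q : ℂ) = C.card * (Fintype.card F : ℂ) ^ (n + 1) := by
        apply mul_right_cancel₀ hx
        linear_combination hid / 2
      have h' : Nat.card Q = C.card * Fintype.card F ^ (n + 1) := by exact_mod_cast h
      exact h'.le
    · have hx : (Fintype.card F : ℂ) ^ n - Fintype.card F ≠ 0 := by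
        rw [sub_ne_zero]
        exact_mod_cast hlt.ne'
      rw [ho.neg_one_pow] at hid
      have h : (Nat.card Q : ℂ) = C.card * (Fintype.card F : ℂ) ^ n := by
        apply mul_right_cancel₀ hx
        linear_combination hid / 2
      have h' : Nat.card Q = C.card * Fintype.card F ^ n := by exact_mod_cast h
      rw [h']
      exact Nat.mul_le_mul_left _ (Nat.pow_le_pow_right hq.le n.le_succ)
  rw [Module.natCard_eq_pow_finrank (K := F), Nat.card_eq_fintype_card] at hbound
  have h := hbound.trans (Nat.mul_le_mul_right _ hle)
  rw [← pow_add, Nat.pow_le_pow_iff_right hq] at h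
  obtain ⟨m, rfl⟩ : ∃ m, n = m + 1 := ⟨n - 1, by omega⟩
  rw [Nat.choose_succ_succ (m + 1) 1, Nat.choose_succ_succ m 1, Nat.choose_one_right,
    Nat.choose_one_right] at hQ
  simp only [Nat.add_sub_cancel, Nat.succ_eq_add_one, Nat.reduceAdd] at h hQ
  omega

end Core

section QuadraticForms

open MvPolynomial

/-- The linear form with the given vector of coefficients. -/
noncomputable def linForm (F : Type*) [Field F] (n : ℕ) :
    (Fin n → F) →ₗ[F] MvPolynomial (Fin n) F :=
  Fintype.linearCombination F X

variable {F : Type*} [Field F] {n : ℕ}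

theorem range_linForm : LinearMap.range (linForm F n) = homogeneousSubmodule (Fin n) F 1 := by
  rw [linForm, Fintype.range_linearCombination, homogeneousSubmodule_one_eq_span_X]

theorem isHomogeneous_linForm (u : Fin n → F) : (linForm F n u).IsHomogeneous 1 := by
  rw [← mem_homogeneousSubmodule, ← range_linForm]
  exact LinearMap.mem_range_self _ u

theorem eval_single_linForm (i : Fin n) (u : Fin n → F) :
    eval (Pi.single i 1) (linForm F n u) = u i := by
  simp [linForm, Fintype.linearCombination_apply, smul_eval, Pi.single_apply]

/-- Multiplication of linear forms, as a bilinear map to quadratic forms. -/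
noncomputable def linFormMul (F : Type*) [Field F] (n : ℕ) :
    (Fin n → F) →ₗ[F] (Fin n → F) →ₗ[F] homogeneousSubmodule (Fin n) F 2 :=
  LinearMap.mk₂ F
    (fun u v => ⟨linForm F n u * linForm F n v,
      (isHomogeneous_linForm u).mul (isHomogeneous_linForm v)⟩)
    (fun u u' v => Subtype.ext (by simp [add_mul]))
    (fun r u v => Subtype.ext (by simp))
    (fun u v v' => Subtype.ext (by simp [mul_add]))
    (fun r u v => Subtype.ext (by simp))

theorem coe_linFormMul (u v : Fin n → F) :
    (linFormMul F n u v : MvPolynomial (Fin n) F) = linForm F n u * linForm F n v :=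
  rfl

theorem linFormMul_comm (u v : Fin n → F) : linFormMul F n u v = linFormMul F n v u :=
  Subtype.ext (mul_comm _ _)

theorem span_range_linFormMul :
    span F (Set.range fun p : (Fin n → F) × (Fin n → F) => linFormMul F n p.1 p.2) = ⊤ := by
  apply Submodule.map_injective_of_injective (homogeneousSubmodule (Fin n) F 2).subtype_injective
  rw [Submodule.map_subtype_top]
  apply le_antisymm (Submodule.map_subtype_le _ _)
  refine (homogeneousSubmodule_one_pow (σ := Fin n) F 2).ge.trans ?_
  rw [pow_two, ← range_linForm, Submodule.mul_le]
  rintro _ ⟨u, rfl⟩ _ ⟨v, rfl⟩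
  exact ⟨linFormMul F n u v, Submodule.subset_span ⟨(u, v), rfl⟩, rfl⟩

theorem linForm_eq_zero {u : Fin n → F} (h : linForm F n u = 0) : u = 0 := by
  ext i
  rw [← eval_single_linForm i u, h, map_zero, Pi.zero_apply]

theorem eq_zero_or_eq_zero_of_linFormMul_eq_zero (u v : Fin n → F) (h : linFormMul F n u v = 0) :
    u = 0 ∨ v = 0 := by
  rw [← Subtype.coe_inj, coe_linFormMul, ZeroMemClass.coe_zero, mul_eq_zero] at h
  exact h.imp linForm_eq_zero linForm_eq_zero

theorem eq_zero_of_normForm_linFormMul_eq_zero {a : F} (ha : ∀ r : F, r ^ 2 ≠ a + 1 * r)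
    (w : Fin n → QuadraticAlgebra F a 1) (h : normForm (linFormMul F n) w = 0) : w = 0 := by
  have : Fact (∀ r : F, r ^ 2 ≠ a + 1 * r) := ⟨ha⟩
  ext1 i
  have hi := congrArg (fun p : homogeneousSubmodule (Fin n) F 2 => eval (Pi.single i 1) p.1) h
  simp only [normForm, Submodule.coe_sub, Submodule.coe_add, Submodule.coe_smul, coe_linFormMul,
    map_sub, map_add, map_mul, smul_eval, eval_single_linForm, ZeroMemClass.coe_zero,
    map_zero] at hi
  rw [Pi.zero_apply, ← QuadraticAlgebra.norm_eq_zero_iff_eq_zero, QuadraticAlgebra.norm_def]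
  simp only [reVec, imVec, LinearMap.coe_mk, AddHom.coe_mk] at hi
  linear_combination hi

instance finiteDimensional_homogeneousSubmodule (d : ℕ) :
    FiniteDimensional F (homogeneousSubmodule (Fin n) F d) :=
  Module.Finite.iff_fg.2 (homogeneousSubmodule_fg (Fin n) F d)

theorem choose_le_finrank_homogeneousSubmodule_two :
    (n + 1).choose 2 ≤ finrank F (homogeneousSubmodule (Fin n) F 2) := by
  let e : Sym2 (Fin n) → Fin n →₀ ℕ := fun z => Multiset.toFinsupp (Sym2.equivMultiset _ z).1
  have he : Function.Injective e :=
    Multiset.toFinsupp.injective.comp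
      (Subtype.val_injective.comp (Sym2.equivMultiset (Fin n)).injective)
  have hdeg : ∀ z, (monomial (e z) (1 : F)).IsHomogeneous 2 := fun z =>
    isHomogeneous_monomial _ (by
      rw [Finsupp.degree_apply]
      exact (Multiset.toFinsupp_sum_eq _).trans (Sym2.equivMultiset _ z).2)
  let f : Sym2 (Fin n) → homogeneousSubmodule (Fin n) F 2 := fun z => ⟨_, hdeg z⟩
  have hf : LinearIndependent F f := by
    apply LinearIndependent.of_comp (Submodule.subtype _)
    have h := (basisMonomials (Fin n) F).linearIndependent.comp e he
    rwa [coe_basisMonomials] at h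
  have h := hf.fintype_card_le_finrank
  rwa [Sym2.card, Fintype.card_fin] at h

theorem wt_le_two (u v u' v' : Fin n → F) :
    wt (linForm F n u * linForm F n v + linForm F n u' * linForm F n v') ≤ 2 := by
  refine Nat.sInf_le ⟨![linForm F n u, linForm F n u'], ![linForm F n v, linForm F n v'], ?_, ?_⟩
  · intro i
    fin_cases i <;> exact ⟨isHomogeneous_linForm _, isHomogeneous_linForm _⟩
  · simp

end QuadraticForms

theorem stmt16 {F : Type*} [Field F] [Fintype F] (n : ℕ) (hn : 3 ≤ n)
    (C : Set (MvPolynomial (Fin n) F))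
    (hhom : ∀ Q ∈ C, Q.IsHomogeneous 2)
    (hwt : ∀ Q ∈ C, ∀ Q' ∈ C, Q ≠ Q' → 3 ≤ wt (Q - Q')) :
    C.ncard < Fintype.card F ^ ((n - 1) * (n - 2) / 2) := by
  obtain ⟨a, ha⟩ := exists_sq_ne_add_self (F := F)
  have : Finite (MvPolynomial.homogeneousSubmodule (Fin n) F 2) := Module.finite_of_finite F
  have := Fintype.ofFinite (MvPolynomial.homogeneousSubmodule (Fin n) F 2)
  classical
  let D : Finset (MvPolynomial.homogeneousSubmodule (Fin n) F 2) := {c | c.1 ∈ C}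
  have hCD : Subtype.val '' (D : Set (MvPolynomial.homogeneousSubmodule (Fin n) F 2)) = C := by
    ext c
    simp only [D, Set.mem_image, Finset.mem_coe, Finset.mem_filter_univ]
    exact ⟨fun ⟨c, hc, h⟩ => h ▸ hc, fun hc => ⟨⟨c, hhom c hc⟩, hc, rfl⟩⟩
  rw [← hCD, Set.ncard_image_of_injective _ Subtype.val_injective, Set.ncard_coe_finset,
    show n - 2 = n - 1 - 1 by omega, ← Nat.choose_two_right]
  refine card_lt_of_forall_sub_ne hn ha linFormMul_comm span_range_linFormMul
    eq_zero_or_eq_zero_of_linFormMul_eq_zero (eq_zero_of_normForm_linFormMul_eq_zero ha)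
    choose_le_finrank_homogeneousSubmodule_two ?_
  intro c hc c' hc' hne u v u' v' h
  have h3 := hwt c (by simpa [D] using hc) c' (by simpa [D] using hc') (Subtype.coe_ne_coe.2 hne)
  have h2 := congrArg Subtype.val h
  rw [Submodule.coe_sub, Submodule.coe_add, coe_linFormMul, coe_linFormMul] at h2
  rw [h2] at h3
  exact absurd (h3.trans (wt_le_two u v u' v')) (by norm_num)
end

section
/- Let F be an algebraically closed field and L/F a nontrivial field extension. Let S, T be finite-dimensional F-subspaces of L with dim(S) ≥ 2, dim(T) ≥ 2 and dim(ST) = dim(S) + dim(T) − 1. Then there exist g, g′, a ∈ L such that {g, ga, …, g a^{dim S − 1}} is a basis of S and {g′, g′a, …, g′ a^{dim T − 1}} is a basis of T. -/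
open Module Submodule

section LinearVosper

variable {F L : Type*} [Field F] [Field L] [Algebra F L]

/-- A nontrivial finitely generated algebra over an algebraically closed field has a rational point. -/
theorem exists_algHom_of_finiteType [IsAlgClosed F] (A : Type*) [CommRing A] [Nontrivial A]
    [Algebra F A] [Algebra.FiniteType F A] : Nonempty (A →ₐ[F] F) := by
  obtain ⟨m, hm⟩ := Ideal.exists_maximal A
  let := Ideal.Quotient.field m
  have : Module.Finite F (A ⧸ m) := finite_of_finite_type_of_isJacobsonRing F (A ⧸ m)
  have hb : Function.Bijective (algebraMap F (A ⧸ m)) :=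
    IsAlgClosed.algebraMap_bijective_of_isIntegral
  exact ⟨((AlgEquiv.ofBijective (Algebra.ofId F (A ⧸ m)) hb).symm : (A ⧸ m) →ₐ[F] F).comp
    (Ideal.Quotient.mkₐ F m)⟩

/-- A linear functional, nonzero at a point of `S`, cuts `S` in a hyperplane. -/
theorem finrank_inf_ker_add_one {V : Type*} [AddCommGroup V] [Module F V] (S : Submodule F V)
    [FiniteDimensional F S] (f : V →ₗ[F] F) {s : V} (hs : s ∈ S) (hf : f s ≠ 0) :
    finrank F ↥(S ⊓ LinearMap.ker f) + 1 = finrank F S := by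
  have hne : f.domRestrict S ≠ 0 := fun h => hf (by simpa using LinearMap.congr_fun h ⟨s, hs⟩)
  have hker : finrank F (LinearMap.ker (f.domRestrict S)) = finrank F ↥(S ⊓ LinearMap.ker f) := by
    rw [LinearMap.ker_domRestrict, ← map_comap_subtype]
    exact ((LinearMap.ker f).comap S.subtype |>.equivMapOfInjective S.subtype
      S.subtype_injective).finrank_eq
  rw [← hker]
  exact Module.Dual.finrank_ker_add_one_of_ne_zero hne

theorem finrank_span_singleton_mul {x : L} (hx : x ≠ 0) (S : Submodule F L) :
    finrank F ↥(span F {x} * S) = finrank F S := by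
  have hmap : span F {x} * S = S.map (LinearMap.mulLeft F x) :=
    ext fun _ => mem_span_singleton_mul
  rw [hmap]
  exact (S.equivMapOfInjective _ (mul_right_injective₀ hx)).finrank_eq.symm

theorem finiteDimensional_mul (S T : Submodule F L) [FiniteDimensional F S]
    [FiniteDimensional F T] : FiniteDimensional F ↥(S * T) :=
  Module.Finite.iff_fg.mpr
    ((Module.Finite.iff_fg.mp inferInstance).mul (Module.Finite.iff_fg.mp inferInstance))

/-- Passing to a suitable hyperplane of `S` lowers the dimension of `S * T`. -/
theorem exists_hyperplane_finrank_mul_lt [IsAlgClosed F] (S T : Submodule F L)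
    [FiniteDimensional F S] [FiniteDimensional F T] (hS : S ≠ ⊥) (hT : T ≠ ⊥) :
    ∃ S' : Submodule F L, S' ≤ S ∧ finrank F S' + 1 = finrank F S ∧
      finrank F ↥(S' * T) + 1 ≤ finrank F ↥(S * T) := by
  obtain ⟨s, hs, hs0⟩ := S.exists_mem_ne_zero_of_ne_bot hS
  obtain ⟨t, ht, ht0⟩ := T.exists_mem_ne_zero_of_ne_bot hT
  obtain ⟨X, hX⟩ : (span F {s⁻¹} * S).FG :=
    (fg_span_singleton _).mul (Module.Finite.iff_fg.mp inferInstance)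
  obtain ⟨Y, hY⟩ : (span F {t⁻¹} * T).FG :=
    (fg_span_singleton _).mul (Module.Finite.iff_fg.mp inferInstance)
  classical
  let A := Algebra.adjoin F ((X ∪ Y : Finset L) : Set L)
  have hXA : span F {s⁻¹} * S ≤ A.toSubmodule := by
    rw [← hX, span_le]
    exact fun x hx => Algebra.subset_adjoin (by simp [Finset.mem_coe.mp hx])
  have hYA : span F {t⁻¹} * T ≤ A.toSubmodule := by
    rw [← hY, span_le]
    exact fun x hx => Algebra.subset_adjoin (by simp [Finset.mem_coe.mp hx])
  have hfin : Algebra.FiniteType F A :=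
    A.fg_iff_finiteType.mp (Subalgebra.fg_adjoin_finset _)
  obtain ⟨φ⟩ := exists_algHom_of_finiteType (F := F) A
  obtain ⟨f, hf⟩ := LinearMap.exists_extend (p := A.toSubmodule) φ.toLinearMap
  have hfA (x : L) (hx : x ∈ A) : f x = φ ⟨x, hx⟩ := LinearMap.congr_fun hf ⟨x, hx⟩
  have hf1 : f 1 = 1 := by rw [hfA 1 A.one_mem]; exact map_one φ
  have hfmul (x y : L) (hx : x ∈ A) (hy : y ∈ A) : f (x * y) = f x * f y := by
    rw [hfA x hx, hfA y hy, hfA _ (A.mul_mem hx hy), ← map_mul]; rfl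
  have hSA (x : L) (hx : x ∈ S) : s⁻¹ * x ∈ A :=
    hXA (mul_mem_mul (mem_span_singleton_self _) hx)
  have hTA (x : L) (hx : x ∈ T) : t⁻¹ * x ∈ A :=
    hYA (mul_mem_mul (mem_span_singleton_self _) hx)
  let fS : L →ₗ[F] F := f ∘ₗ LinearMap.mulLeft F s⁻¹
  let fST : L →ₗ[F] F := f ∘ₗ LinearMap.mulLeft F (s⁻¹ * t⁻¹)
  have := finiteDimensional_mul S T
  refine ⟨S ⊓ LinearMap.ker fS, inf_le_left,
    finrank_inf_ker_add_one S fS hs (by simp [fS, hs0, hf1]), ?_⟩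
  have hst : fST (s * t) ≠ 0 := by
    have : s⁻¹ * t⁻¹ * (s * t) = 1 := by field_simp
    simp only [fST, LinearMap.comp_apply, LinearMap.mulLeft_apply, this, hf1]
    exact one_ne_zero
  rw [← finrank_inf_ker_add_one (S * T) fST (mul_mem_mul hs ht) hst]
  gcongr
  refine finrank_mono (le_inf (mul_le_mul_left inf_le_left T) (mul_le.mpr ?_))
  rintro x ⟨hxS, hx⟩ y hy
  have hx' : f (s⁻¹ * x) = 0 := by simpa [fS] using hx
  have : s⁻¹ * t⁻¹ * (x * y) = s⁻¹ * x * (t⁻¹ * y) := by ring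
  simp only [LinearMap.mem_ker, fST, LinearMap.comp_apply, LinearMap.mulLeft_apply]
  rw [this, hfmul _ _ (hSA x hxS) (hTA y hy), hx', zero_mul]

theorem finrank_add_finrank_le_finrank_mul_add_one [IsAlgClosed F] (S T : Submodule F L)
    [FiniteDimensional F S] [FiniteDimensional F T] (hS : S ≠ ⊥) (hT : T ≠ ⊥) :
    finrank F S + finrank F T ≤ finrank F ↥(S * T) + 1 := by
  induction hn : finrank F S generalizing S with
  | zero => exact absurd (finrank_eq_zero.mp hn) hS
  | succ n ih =>
    obtain ⟨S', hle, hS', hlt⟩ := exists_hyperplane_finrank_mul_lt S T hS hT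
    have := finiteDimensional_of_le hle
    by_cases h : S' = ⊥
    · obtain ⟨s, hs, hs0⟩ := S.exists_mem_ne_zero_of_ne_bot hS
      have hle : span F {s} * T ≤ S * T :=
        mul_le_mul_left ((span_singleton_le_iff_mem _ _).mpr hs) T
      have := finiteDimensional_mul S T
      have h1 := finrank_mono hle
      rw [finrank_span_singleton_mul hs0] at h1
      have : finrank F S' = 0 := by rw [h, finrank_bot]
      omega
    · have := ih S' h (by omega)
      omega

/-- Descend from `S` to a two-dimensional subspace keeping the product with `T` minimal. -/
theorem exists_finrank_eq_two_finrank_mul_le [IsAlgClosed F] (S T : Submodule F L)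
    [FiniteDimensional F S] [FiniteDimensional F T] (hS : 2 ≤ finrank F S) (hT : T ≠ ⊥)
    (hST : finrank F ↥(S * T) + 1 ≤ finrank F S + finrank F T) :
    ∃ P : Submodule F L, finrank F P = 2 ∧ finrank F ↥(P * T) ≤ finrank F T + 1 := by
  obtain ⟨n, hn⟩ := Nat.exists_eq_add_of_le' hS
  induction n generalizing S with
  | zero => exact ⟨S, by omega, by omega⟩
  | succ n ih =>
    have hS0 : S ≠ ⊥ := by rintro rfl; simp at hS
    obtain ⟨S', hle, hS', hlt⟩ := exists_hyperplane_finrank_mul_lt S T hS0 hT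
    have := finiteDimensional_of_le hle
    exact ih S' (by omega) (by omega) (by omega)

theorem exists_span_pair_eq_of_finrank_eq_two (P : Submodule F L) (hP : finrank F P = 2) :
    ∃ s a : L, s ≠ 0 ∧ span F {s} * span F {1, a} = P := by
  have hfd : FiniteDimensional F P := FiniteDimensional.of_finrank_pos (by omega)
  let b := finBasisOfFinrankEq F P hP
  have hb0 : (b 0 : L) ≠ 0 := by simpa using b.ne_zero 0
  refine ⟨b 0, (b 0 : L)⁻¹ * b 1, hb0, ?_⟩
  rw [span_mul_span, Set.singleton_mul, Set.image_pair, mul_one, mul_inv_cancel_left₀ hb0]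
  have := congrArg (map P.subtype) b.span_eq
  rw [map_span, Submodule.map_top, range_subtype] at this
  refine Eq.trans ?_ this
  congr 1
  ext x
  simp [Fin.exists_fin_two, eq_comm]

/-- If multiplying `T` by `⟨1, a⟩` raises the dimension by at most one, then `T` is itself
a multiple of `⟨1, a⟩`. -/
theorem exists_span_pair_mul_eq [IsAlgClosed F] {a : L}
    (hP : finrank F ↥(span F {1, a}) = 2) (T : Submodule F L) [FiniteDimensional F T]
    (hT : 2 ≤ finrank F T) (hle : finrank F ↥(span F {1, a} * T) ≤ finrank F T + 1) :
    ∃ T' : Submodule F L, finrank F T' + 1 = finrank F T ∧ span F {1, a} * T' = T := by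
  have ha : a ≠ 0 := by
    rintro rfl
    have : span F {(1 : L), 0} = span F {1} := by rw [Set.pair_comm, span_insert_zero]
    rw [this, finrank_span_singleton one_ne_zero] at hP
    omega
  have hPT : span F {1, a} * T = T ⊔ span F {a} * T := by
    rw [span_insert, Submodule.sup_mul, ← one_eq_span, one_mul]
  have := finiteDimensional_mul (span F {a}) T
  have hdim := finrank_sup_add_finrank_inf_eq T (span F {a} * T)
  rw [← hPT, finrank_span_singleton_mul ha] at hdim
  let T' := span F {a⁻¹} * (T ⊓ span F {a} * T)
  have hinv : span F {a} * T' = T ⊓ span F {a} * T := by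
    rw [← mul_assoc, span_mul_span, Set.singleton_mul_singleton, mul_inv_cancel₀ ha,
      ← one_eq_span, one_mul]
  have hT'T : T' ≤ T := by
    calc T' ≤ span F {a⁻¹} * (span F {a} * T) := mul_le_mul_right inf_le_right _
      _ = T := by
        rw [← mul_assoc, span_mul_span, Set.singleton_mul_singleton, inv_mul_cancel₀ ha,
          ← one_eq_span, one_mul]
  have hT'rank : finrank F T' = finrank F ↥(T ⊓ span F {a} * T) :=
    finrank_span_singleton_mul (inv_ne_zero ha) _
  have hPT' : span F {1, a} * T' ≤ T := by
    rw [span_insert, Submodule.sup_mul, ← one_eq_span, one_mul, hinv]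
    exact sup_le hT'T inf_le_left
  have := finiteDimensional_of_le hT'T
  have hT'0 : T' ≠ ⊥ := by
    intro h
    rw [h, finrank_bot] at hT'rank
    omega
  have hP0 : span F {1, a} ≠ ⊥ := by
    intro h
    rw [h, finrank_bot] at hP
    omega
  have hfd : FiniteDimensional F ↥(span F {1, a}) := FiniteDimensional.of_finrank_pos (by omega)
  have hlow := finrank_add_finrank_le_finrank_mul_add_one _ T' hP0 hT'0
  have hmono := finrank_mono hPT'
  exact ⟨T', by omega, eq_of_le_of_finrank_le hPT' (by omega)⟩

theorem exists_eq_span_geometric [IsAlgClosed F] {a : L}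
    (hP : finrank F ↥(span F {1, a}) = 2) (T : Submodule F L)
    (n : ℕ) (hT : finrank F T = n + 1)
    (hle : finrank F ↥(span F {1, a} * T) ≤ finrank F T + 1) :
    ∃ g : L, T = span F (Set.range fun i : Fin (n + 1) => g * a ^ (i : ℕ)) := by
  have hfd : FiniteDimensional F T := FiniteDimensional.of_finrank_pos (by omega)
  induction n generalizing T with
  | zero =>
    obtain ⟨g, -, hg⟩ := finrank_eq_one_iff'.mp hT
    refine ⟨g, le_antisymm (fun x hx => ?_) ?_⟩
    · obtain ⟨c, hc⟩ := hg ⟨x, hx⟩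
      have hc : c • (g : L) = x := congrArg Subtype.val hc
      exact hc ▸ smul_mem _ _ (subset_span ⟨0, by simp⟩)
    · rw [span_le]
      rintro _ ⟨i, rfl⟩
      simp
  | succ n ih =>
    obtain ⟨T', hT', rfl⟩ := exists_span_pair_mul_eq hP T (by omega) hle
    obtain ⟨g, hg⟩ := ih T' (by omega) (by omega)
      (FiniteDimensional.of_finrank_pos (by omega))
    refine ⟨g, ?_⟩
    rw [hg, span_mul_span]
    congr 1
    ext x
    simp only [Set.mem_mul, Set.mem_range, Set.mem_insert_iff, Set.mem_singleton_iff]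
    constructor
    · rintro ⟨_, rfl | rfl, _, ⟨i, rfl⟩, rfl⟩
      · exact ⟨i.castSucc, by simp⟩
      · exact ⟨i.succ, by simp [pow_succ]; ring⟩
    · rintro ⟨i, rfl⟩
      induction i using Fin.cases with
      | zero => exact ⟨1, .inl rfl, _, ⟨0, rfl⟩, by simp⟩
      | succ i => exact ⟨a, .inr rfl, _, ⟨i, rfl⟩, by simp [pow_succ]; ring⟩

theorem exists_basis_geometric [IsAlgClosed F] {a : L}
    (hP : finrank F ↥(span F {1, a}) = 2) (T : Submodule F L) (hT : 0 < finrank F T)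
    (hle : finrank F ↥(span F {1, a} * T) ≤ finrank F T + 1) :
    ∃ (g : L) (b : Basis (Fin (finrank F T)) F T), ∀ i, (b i : L) = g * a ^ (i : ℕ) := by
  obtain ⟨n, hn⟩ := Nat.exists_eq_add_of_le' hT
  obtain ⟨g, hg⟩ := exists_eq_span_geometric hP T n hn hle
  rw [← hn] at hg
  have hmem (i : Fin (finrank F T)) : g * a ^ (i : ℕ) ∈ T := by
    have : g * a ^ (i : ℕ) ∈ span F (Set.range fun i : Fin (finrank F T) => g * a ^ (i : ℕ)) :=
      subset_span ⟨i, rfl⟩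
    exact hg.ge this
  let v : Fin (finrank F T) → T := fun i => ⟨g * a ^ (i : ℕ), hmem i⟩
  have hspan : ⊤ ≤ span F (Set.range v) := by
    rw [← map_le_map_iff_of_injective T.subtype_injective, Submodule.map_top, range_subtype, map_span,
      ← Set.range_comp]
    exact hg.le
  have : FiniteDimensional F T := FiniteDimensional.of_finrank_pos hT
  exact ⟨g, basisOfTopLeSpanOfCardEqFinrank v hspan (by simp), by simp [v]⟩

end LinearVosper

theorem stmt19 {F L : Type*} [Field F] [IsAlgClosed F] [Field L] [Algebra F L]
    (hnt : ¬ Function.Surjective (algebraMap F L))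
    (S T : Submodule F L)
    (hSfd : FiniteDimensional F ↥S) (hTfd : FiniteDimensional F ↥T)
    (hS2 : 2 ≤ finrank F ↥S) (hT2 : 2 ≤ finrank F ↥T)
    (hST : finrank F ↥(S * T) = finrank F ↥S + finrank F ↥T - 1) :
    ∃ g g' a : L,
      (∃ bS : Basis (Fin (finrank F ↥S)) F ↥S, ∀ i, (bS i : L) = g * a ^ (i : ℕ)) ∧
      (∃ bT : Basis (Fin (finrank F ↥T)) F ↥T, ∀ i, (bT i : L) = g' * a ^ (i : ℕ)) := by
  have ne_bot (U : Submodule F L) (hU : 0 < finrank F U) : U ≠ ⊥ := by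
    rintro rfl
    simp at hU
  obtain ⟨Q, hQ, hQT⟩ :=
    exists_finrank_eq_two_finrank_mul_le S T hS2 (ne_bot T (by omega)) (by omega)
  obtain ⟨s, a, hs, rfl⟩ := exists_span_pair_eq_of_finrank_eq_two Q hQ
  rw [finrank_span_singleton_mul hs] at hQ
  rw [mul_assoc, finrank_span_singleton_mul hs] at hQT
  obtain ⟨T', hT', hPT'⟩ := exists_span_pair_mul_eq hQ T hT2 hQT
  have hPfd : FiniteDimensional F ↥(span F {1, a}) := FiniteDimensional.of_finrank_pos (by omega)
  have hT'fd : FiniteDimensional F T' := FiniteDimensional.of_finrank_pos (by omega)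
  have hPS : finrank F ↥(span F {1, a} * S) ≤ finrank F S + 1 := by
    have := finiteDimensional_mul (span F {1, a}) S
    have hlow := finrank_add_finrank_le_finrank_mul_add_one (span F {1, a} * S) T'
      (mul_ne_zero (ne_bot _ (by omega)) (ne_bot S (by omega))) (ne_bot T' (by omega))
    rw [mul_comm (span F {1, a}) S, mul_assoc, hPT'] at hlow
    rw [mul_comm (span F {1, a}) S]
    omega
  obtain ⟨g, bS, hbS⟩ := exists_basis_geometric hQ S (by omega) hPS
  obtain ⟨g', bT, hbT⟩ := exists_basis_geometric hQ T (by omega) hQT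
  exact ⟨g, g', a, ⟨bS, hbS⟩, ⟨bT, hbT⟩⟩
end
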